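/- arXiv:2404.15135 — 10 statements merged into one kernel-verified Lean document; each statement's English description precedes it below -/
import Mathlib

section
/- Let q be a prime power, f : F_q^k → Y a function, and t ∈ ℕ. If there exists an (f,t)-function-correcting code with redundancy r, then q^k ≤ q^r · α(G_f(t,k,0)); equivalently, the redundancy of any (f,t)-FCC satisfies r ≥ k − log_q(α(G_f(t,k,0))). -/
/-- The independence number of a graph: the supremum of the cardinalities of
independent (pairwise non-adjacent) sets of vertices. -/
noncomputable def indepNum {V : Type*} (G : SimpleGraph V) : ℕ :=
  sSup {n | ∃ s : Finset V, (∀ u ∈ s, ∀ v ∈ s, ¬ G.Adj u v) ∧ s.card = n}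

/-- The graph `G_f(t,k,0)` on `F_q^k`: distinct `u, v` are adjacent iff
`f u ≠ f v` and `d_H(u,v) ≤ 2t`. -/
def Gf0 {F Y : Type*} [Fintype F] [DecidableEq F] {k : ℕ}
    (f : (Fin k → F) → Y) (t : ℕ) : SimpleGraph (Fin k → F) :=
  SimpleGraph.fromRel fun u v => f u ≠ f v ∧ hammingDist u v ≤ 2 * t

/-- If there exists an `(f,t)`-function-correcting code with redundancy `r`, then
`q^k ≤ q^r · α(G_f(t,k,0))`. -/
theorem stmt0 {F Y : Type*} [Field F] [Fintype F] [DecidableEq F]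
    {k r t : ℕ} (f : (Fin k → F) → Y) (P : (Fin k → F) → (Fin r → F))
    (hP : ∀ u v : Fin k → F, f u ≠ f v →
      2 * t + 1 ≤ hammingDist u v + hammingDist (P u) (P v)) :
    Fintype.card F ^ k ≤ Fintype.card F ^ r * indepNum (Gf0 f t) := by
  classical
  have key : ∀ b : Fin r → F,
      (Finset.univ.filter (fun u => P u = b)).card ≤ indepNum (Gf0 f t) := by
    intro b
    apply le_csSup
    · refine ⟨Fintype.card (Fin k → F), ?_⟩
      rintro n ⟨s, -, rfl⟩
      exact Finset.card_le_univ s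
    · refine ⟨_, ?_, rfl⟩
      intro u hu v hv h
      simp only [Finset.mem_filter, Finset.mem_univ, true_and] at hu hv
      simp only [Gf0, SimpleGraph.fromRel_adj] at h
      obtain ⟨-, ⟨h1, h2⟩ | ⟨h1, h2⟩⟩ := h
      · have h3 := hP u v h1
        rw [hu, hv, hammingDist_self] at h3
        omega
      · have h3 := hP v u h1
        rw [hu, hv, hammingDist_self] at h3
        omega
  have h := Finset.card_eq_sum_card_fiberwise (f := P)
    (s := (Finset.univ : Finset (Fin k → F))) (t := Finset.univ) (by simp [Set.MapsTo])
  have h2 := Finset.sum_le_card_nsmul (Finset.univ : Finset (Fin r → F))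
    (fun b => (Finset.univ.filter (fun u => P u = b)).card) _ (fun b _ => key b)
  rw [← h] at h2
  simpa using h2
end

section
/- Let q be a prime power, f : F_q^k → Y a function, and t, r ∈ ℕ. Every independent set of the graph G_f(t,k,r) is also an independent set of the Cartesian (box) product graph G_f(t,k,0) □ K, where K is the complete graph on vertex set F_q^r; consequently α(G_f(t,k,r)) ≤ α(G_f(t,k,0) □ K). -/
/-- The graph `G_f(t,k,r)` on `F_q^k × F_q^r`: distinct `(u,x), (v,y)` are
adjacent iff `u = v`, or `f u ≠ f v` and `d_H(u,v) + d_H(x,y) ≤ 2t`. -/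
def GfGraph {F Y : Type*} [Fintype F] [DecidableEq F] {k r : ℕ}
    (f : (Fin k → F) → Y) (t : ℕ) :
    SimpleGraph ((Fin k → F) × (Fin r → F)) :=
  SimpleGraph.fromRel fun x y =>
    x.1 = y.1 ∨ (f x.1 ≠ f y.1 ∧ hammingDist x.1 y.1 + hammingDist x.2 y.2 ≤ 2 * t)

/-- Every independent set of `G_f(t,k,r)` is an independent set of the box
product `G_f(t,k,0) □ K`, where `K` is the complete graph on `F_q^r`;
consequently `α(G_f(t,k,r)) ≤ α(G_f(t,k,0) □ K)`. -/
theorem stmt1 {F Y : Type*} [Field F] [Fintype F] [DecidableEq F]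
    {k r t : ℕ} (f : (Fin k → F) → Y) :
    (∀ s : Set ((Fin k → F) × (Fin r → F)),
      (∀ x ∈ s, ∀ y ∈ s, ¬ (GfGraph (r := r) f t).Adj x y) →
      (∀ x ∈ s, ∀ y ∈ s,
        ¬ (SimpleGraph.boxProd (Gf0 f t) (⊤ : SimpleGraph (Fin r → F))).Adj x y)) ∧
    indepNum (GfGraph (r := r) f t) ≤
      indepNum (SimpleGraph.boxProd (Gf0 f t) (⊤ : SimpleGraph (Fin r → F))) := by
  have key : ∀ x y : (Fin k → F) × (Fin r → F),
      (SimpleGraph.boxProd (Gf0 f t) (⊤ : SimpleGraph (Fin r → F))).Adj x y →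
      (GfGraph (r := r) f t).Adj x y := by
    rintro ⟨u, x⟩ ⟨v, y⟩ h
    rw [SimpleGraph.boxProd_adj] at h
    simp only [Gf0, GfGraph, SimpleGraph.fromRel_adj, SimpleGraph.top_adj] at h ⊢
    rcases h with ⟨⟨hne, h⟩, rfl⟩ | ⟨hne, rfl⟩
    · refine ⟨fun e => hne (congrArg Prod.fst e), ?_⟩
      simp only [hammingDist_self, add_zero]
      rcases h with h | h
      · exact Or.inl (Or.inr h)
      · exact Or.inr (Or.inr h)
    · exact ⟨fun e => hne (congrArg Prod.snd e), Or.inl (Or.inl rfl)⟩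
  refine ⟨fun s hs x hx y hy h => hs x hx y hy (key x y h), ?_⟩
  unfold indepNum
  apply csSup_le_csSup
  · refine ⟨Fintype.card ((Fin k → F) × (Fin r → F)), ?_⟩
    rintro n ⟨s, -, rfl⟩
    exact Finset.card_le_univ s
  · exact ⟨0, ∅, by simp, rfl⟩
  · rintro n ⟨s, hs, rfl⟩
    exact ⟨s, fun x hx y hy h => hs x hx y hy (key x y h), rfl⟩
end

section
/- Let q be a prime power and k, d ∈ ℕ with 2 ≤ k and d ≤ k. Suppose there exists a linear [k+d−1, k, d]_q MDS code, i.e., a k-dimensional linear subspace of F_q^{k+d−1} all of whose nonzero vectors have Hamming weight ≥ d. Then A_q(k,d) = q^{k−d+1}; consequently the parameters r := d−1, k, d satisfy the systematic-code redundancy bound q^k ≤ q^r · A_q(k,d) with equality. -/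
/-- `A_q(k,d)`: the maximum cardinality of a subset of `F_q^k` whose distinct
elements have pairwise Hamming distance at least `d`. -/
noncomputable def Aq (F : Type*) [Fintype F] [DecidableEq F] (k d : ℕ) : ℕ :=
  sSup {m | ∃ C : Finset (Fin k → F),
    (∀ u ∈ C, ∀ v ∈ C, u ≠ v → d ≤ hammingDist u v) ∧ C.card = m}

theorem aux_upper {F : Type*} [Fintype F] [DecidableEq F] (m e : ℕ)
    (D : Finset (Fin (m + e) → F))
    (hD : ∀ u ∈ D, ∀ v ∈ D, u ≠ v → e + 1 ≤ hammingDist u v) :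
    D.card ≤ Fintype.card F ^ m := by
  have h1 : D.card ≤ (Finset.univ : Finset (Fin m → F)).card := by
    apply Finset.card_le_card_of_injOn (fun u i => u (Fin.castAdd e i)) (by simp)
    intro u hu v hv huv
    by_contra hne
    have h2 := hD u hu v hv hne
    have h3 : hammingDist u v ≤ ((Finset.univ : Finset (Fin e)).image (Fin.natAdd m)).card := by
      apply Finset.card_le_card
      intro i hi
      simp only [Finset.mem_filter, Finset.mem_univ, true_and] at hi
      simp only [Finset.mem_image, Finset.mem_univ, true_and]
      induction i using Fin.addCases with
      | left i => exact absurd (congrFun huv i) hi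
      | right i => exact ⟨i, rfl⟩
    have h4 := h3.trans Finset.card_image_le
    simp at h4
    omega
  simpa using h1

theorem aux_lower {F : Type*} [Field F] [Fintype F] [DecidableEq F] (m e : ℕ)
    (C : Submodule F (Fin (m + e + e) → F))
    (hdim : Module.finrank F C = m + e)
    (hwt : ∀ x ∈ C, x ≠ 0 → e + 1 ≤ hammingNorm x) :
    ∃ D : Finset (Fin (m + e) → F),
      (∀ u ∈ D, ∀ v ∈ D, u ≠ v → e + 1 ≤ hammingDist u v) ∧ Fintype.card F ^ m ≤ D.card := by
  classical
  let p : C →ₗ[F] (Fin e → F) :=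
    (LinearMap.funLeft F F (Fin.natAdd (m + e))).comp C.subtype
  have hr := p.finrank_range_add_finrank_ker
  have hr2 := Submodule.finrank_le (LinearMap.range p)
  rw [Module.finrank_fin_fun] at hr2
  have hK : m ≤ Module.finrank F (LinearMap.ker p) := by omega
  let r : LinearMap.ker p → (Fin (m + e) → F) := fun x i => (x : C).1 (Fin.castAdd e i)
  have hz : ∀ x : LinearMap.ker p, ∀ i, (x : C).1 (Fin.natAdd (m + e) i) = 0 := by
    intro x i
    exact congrFun (LinearMap.mem_ker.1 x.2) i
  have hinj : Function.Injective r := by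
    intro x y hxy
    apply Subtype.ext
    apply Subtype.ext
    funext i
    induction i using Fin.addCases with
    | left i => exact congrFun hxy i
    | right i => rw [hz, hz]
  refine ⟨Finset.univ.image r, ?_, ?_⟩
  · intro u hu v hv huv
    simp only [Finset.mem_image, Finset.mem_univ, true_and] at hu hv
    obtain ⟨x, rfl⟩ := hu
    obtain ⟨y, rfl⟩ := hv
    have hne : (x : C).1 - (y : C).1 ≠ 0 := by
      intro h
      apply huv
      have : x = y := Subtype.ext (Subtype.ext (sub_eq_zero.1 h))
      rw [this]
    refine (hwt _ (C.sub_mem (x : C).2 (y : C).2) hne).trans ?_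
    have h3 : hammingNorm ((x : C).1 - (y : C).1) ≤
        ((Finset.univ.filter (fun i => r x i ≠ r y i)).image (Fin.castAdd e)).card := by
      apply Finset.card_le_card
      intro i hi
      simp only [Finset.mem_filter, Finset.mem_univ, true_and, Pi.sub_apply] at hi
      simp only [Finset.mem_image, Finset.mem_filter, Finset.mem_univ, true_and]
      induction i using Fin.addCases with
      | left i => exact ⟨i, sub_ne_zero.1 hi, rfl⟩
      | right i => rw [hz, hz] at hi; simp at hi
    exact h3.trans Finset.card_image_le
  · rw [Finset.card_image_of_injective _ hinj, Finset.card_univ,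
      Module.card_eq_pow_finrank (K := F) (V := LinearMap.ker p)]
    exact Nat.pow_le_pow_right (Fintype.card_pos (α := F)) hK

/-- If a linear `[k+d−1, k, d]_q` MDS code exists (with `2 ≤ k` and `d ≤ k`),
then `A_q(k,d) = q^{k−d+1}`, and the parameters `r = d−1, k, d` satisfy the
systematic-code redundancy bound `q^k ≤ q^r · A_q(k,d)` with equality. -/
theorem stmt3 {F : Type*} [Field F] [Fintype F] [DecidableEq F]
    {k d : ℕ} (hk : 2 ≤ k) (hdk : d ≤ k)
    (C : Submodule F (Fin (k + d - 1) → F))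
    (hdim : Module.finrank F C = k)
    (hwt : ∀ x ∈ C, x ≠ 0 → d ≤ hammingNorm x) :
    Aq F k d = Fintype.card F ^ (k - d + 1) ∧
    Fintype.card F ^ k = Fintype.card F ^ (d - 1) * Aq F k d := by
  obtain _ | e := d
  · exfalso
    have h := Submodule.finrank_le C
    rw [Module.finrank_fin_fun] at h
    omega
  obtain ⟨m, rfl⟩ : ∃ m, k = m + e := ⟨k - e, by omega⟩
  have hA : Aq F (m + e) (e + 1) = Fintype.card F ^ m := by
    have hub : ∀ x ∈ {x | ∃ C : Finset (Fin (m + e) → F),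
        (∀ u ∈ C, ∀ v ∈ C, u ≠ v → e + 1 ≤ hammingDist u v) ∧ C.card = x},
        x ≤ Fintype.card F ^ m := by
      rintro x ⟨D, hD, rfl⟩
      exact aux_upper m e D hD
    obtain ⟨D, hD, hc⟩ := aux_lower m e C hdim hwt
    apply le_antisymm
    · exact csSup_le ⟨_, D, hD, rfl⟩ hub
    · exact hc.trans (le_csSup ⟨_, hub⟩ ⟨D, hD, rfl⟩)
  have he : m + e - (e + 1) + 1 = m := by omega
  rw [hA, he]
  refine ⟨rfl, ?_⟩
  rw [Nat.add_sub_cancel, ← pow_add, add_comm]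
end

section
/- Let q be a prime power and r ≥ 2 with (q,r) ≠ (2,2). Set n = (q^r − 1)/(q − 1) and k = n − r, and assume k ≥ 3. Then q^{r−1} · A_q(k,3) < q^k ≤ q^r · A_q(k,3); that is, the [n,k,3]_q Hamming code achieves the systematic-code redundancy lower bound r ≥ ⌈k − log_q A_q(k,3)⌉ with equality. -/
lemma code_le_Aq (F : Type*) [Fintype F] [DecidableEq F] (k d : ℕ) (C : Finset (Fin k → F))
    (hC : ∀ u ∈ C, ∀ v ∈ C, u ≠ v → d ≤ hammingDist u v) : C.card ≤ Aq F k d := by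
  apply le_csSup
  · refine ⟨Fintype.card (Fin k → F), ?_⟩
    rintro m ⟨C, -, rfl⟩
    exact Finset.card_le_univ C
  · exact ⟨C, hC, rfl⟩

lemma exists_code_Aq (F : Type*) [Fintype F] [DecidableEq F] (k d : ℕ) :
    ∃ C : Finset (Fin k → F),
      (∀ u ∈ C, ∀ v ∈ C, u ≠ v → d ≤ hammingDist u v) ∧ C.card = Aq F k d := by
  apply Nat.sSup_mem (s := {m | ∃ C : Finset (Fin k → F),
    (∀ u ∈ C, ∀ v ∈ C, u ≠ v → d ≤ hammingDist u v) ∧ C.card = m})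
  · exact ⟨0, ∅, by simp, by simp⟩
  · refine ⟨Fintype.card (Fin k → F), ?_⟩
    rintro m ⟨C, -, rfl⟩
    exact Finset.card_le_univ C

def errVec {F : Type*} [Field F] {k : ℕ} :
    Option (Fin k × {a : F // a ≠ 0}) → (Fin k → F)
  | none => 0
  | some (i, a) => Pi.single i a.1

lemma errVec_inj {F : Type*} [Field F] {k : ℕ} :
    Function.Injective (errVec (F := F) (k := k)) := by
  rintro (_ | ⟨i, a, ha⟩) (_ | ⟨j, b, hb⟩) h
  · rfl
  · have := congrFun h j
    simp [errVec] at this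
    exact absurd this.symm hb
  · have := congrFun h i
    simp [errVec] at this
    exact absurd this ha
  · have h1 := congrFun h i
    simp only [errVec, Pi.single_eq_same] at h1
    by_cases hij : i = j
    · subst hij
      simp at h1
      subst h1
      rfl
    · rw [Pi.single_eq_of_ne hij] at h1
      exact absurd h1 ha

lemma dist_errVec {F : Type*} [Field F] [DecidableEq F] {k : ℕ} (u : Fin k → F)
    (e : Option (Fin k × {a : F // a ≠ 0})) : hammingDist u (u + errVec e) ≤ 1 := by
  rcases e with _ | ⟨i, a, ha⟩
  · simp [errVec]
  · unfold hammingDist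
    refine (Finset.card_le_card (t := {i}) ?_).trans (by simp)
    intro j hj
    by_contra hji
    simp only [Finset.mem_singleton] at hji
    simp [errVec, Pi.single_eq_of_ne hji] at hj

lemma sphere_packing (F : Type*) [Field F] [Fintype F] [DecidableEq F] (k : ℕ) :
    Aq F k 3 * (k * (Fintype.card F - 1) + 1) ≤ Fintype.card F ^ k := by
  obtain ⟨C, hC, hcard⟩ := exists_code_Aq F k 3
  have hinj : Function.Injective
      (fun x : C × Option (Fin k × {a : F // a ≠ 0}) => x.1.1 + errVec x.2) := by
    rintro ⟨⟨u, hu⟩, e⟩ ⟨⟨v, hv⟩, e'⟩ h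
    simp only at h
    have huv : u = v := by
      by_contra hne
      have h1 := hC u hu v hv hne
      have h2 := hammingDist_triangle u (u + errVec e) v
      have h3 := dist_errVec u e
      have h4 := dist_errVec v e'
      rw [← h, hammingDist_comm] at h4
      omega
    subst huv
    have := errVec_inj (add_left_cancel h)
    subst this
    rfl
  have := Fintype.card_le_of_injective _ hinj
  have h0 : Fintype.card {a : F // a ≠ 0} = Fintype.card F - 1 := by
    rw [Fintype.card_subtype_compl, Fintype.card_subtype_eq]
  simp only [Fintype.card_prod, Fintype.card_option, Fintype.card_coe, Fintype.card_fin,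
    Fintype.card_fun, h0, hcard] at this
  exact this

lemma hamming_code_bound (F : Type*) [Field F] [Fintype F] [DecidableEq F] (k r : ℕ)
    (p : Fin k → Projectivization F (Fin r → F)) (hp : Function.Injective p) :
    Fintype.card F ^ k ≤ Fintype.card F ^ r * Aq F k 3 := by
  let H : (Fin k → F) → (Fin r → F) := fun u => ∑ i, u i • (p i).rep
  have key : ∀ u v, H u = H v → u ≠ v → 3 ≤ hammingDist u v := by
    intro u v huv hne
    by_contra hlt
    have hsum : ∑ i with u i ≠ v i, (u i - v i) • (p i).rep = 0 := by
      rw [Finset.sum_filter_of_ne]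
      · simp only [sub_smul, Finset.sum_sub_distrib]
        exact sub_eq_zero.2 huv
      · intro i _ h hi
        exact h (by simp [hi])
    have hpos : 0 < hammingDist u v := hammingDist_pos.2 hne
    have hcases : hammingDist u v = 1 ∨ hammingDist u v = 2 := by omega
    unfold hammingDist at hcases
    rcases hcases with h | h
    · obtain ⟨i, hi⟩ := Finset.card_eq_one.1 h
      have hmem : i ∈ Finset.univ.filter (fun i => u i ≠ v i) := by simp [hi]
      rw [hi, Finset.sum_singleton, smul_eq_zero] at hsum
      rcases hsum with h | h
      · exact (Finset.mem_filter.1 hmem).2 (sub_eq_zero.1 h)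
      · exact (p i).rep_nonzero h
    · obtain ⟨i, j, hij, hi⟩ := Finset.card_eq_two.1 h
      have hmem : i ∈ Finset.univ.filter (fun i => u i ≠ v i) := by simp [hi]
      have hne : u i - v i ≠ 0 := sub_ne_zero.2 (Finset.mem_filter.1 hmem).2
      rw [hi, Finset.sum_pair hij] at hsum
      apply hij
      apply hp
      rw [← (p i).mk_rep, ← (p j).mk_rep, Projectivization.mk_eq_mk_iff']
      refine ⟨-((u i - v i)⁻¹ * (u j - v j)), ?_⟩
      have h5 := eq_neg_of_add_eq_zero_right hsum
      rw [neg_smul, mul_smul, h5, smul_neg, neg_neg, smul_smul, inv_mul_cancel₀ hne, one_smul]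
  have := Finset.card_le_mul_card_image (f := H) Finset.univ (Aq F k 3) (by
    intro a _
    apply code_le_Aq
    intro u hu v hv
    simp only [Finset.mem_filter, Finset.mem_univ, true_and] at hu hv
    exact key u v (hu.trans hv.symm))
  have h2 : (Finset.univ.image H).card ≤ Fintype.card F ^ r := by
    refine (Finset.card_le_univ _).trans ?_
    simp
  rw [Finset.card_univ, Fintype.card_fun, Fintype.card_fin] at this
  rw [mul_comm]
  exact this.trans (Nat.mul_le_mul_left _ h2)

/-- With `n = (q^r − 1)/(q − 1)` and `k = n − r` (Hamming code parameters),
`r ≥ 2`, `(q,r) ≠ (2,2)` and `k ≥ 3`, we have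
`q^{r−1} · A_q(k,3) < q^k ≤ q^r · A_q(k,3)`: the `[n,k,3]_q` Hamming code
achieves the systematic-code redundancy lower bound with equality. -/
theorem stmt4 {F : Type*} [Field F] [Fintype F] [DecidableEq F]
    {n k r : ℕ} (hr : 2 ≤ r) (hqr : ¬(Fintype.card F = 2 ∧ r = 2))
    (hn : n * (Fintype.card F - 1) = Fintype.card F ^ r - 1)
    (hk : k = n - r) (hk3 : 3 ≤ k) :
    Fintype.card F ^ (r - 1) * Aq F k 3 < Fintype.card F ^ k ∧
    Fintype.card F ^ k ≤ Fintype.card F ^ r * Aq F k 3 := by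
  have hq : 2 ≤ Fintype.card F := Fintype.one_lt_card
  constructor
  · have hsp := sphere_packing F k
    generalize Fintype.card F = q at *
    generalize Aq F k 3 = A at *
    rcases Nat.eq_zero_or_pos A with rfl | hA
    · simpa using Nat.pow_pos (by omega)
    refine lt_of_lt_of_le ?_ hsp
    rw [mul_comm]
    refine Nat.mul_lt_mul_of_pos_left ?_ hA
    obtain ⟨s, rfl⟩ : ∃ s, r = s + 2 := ⟨r - 2, by omega⟩
    obtain ⟨t, rfl⟩ : ∃ t, q = t + 1 := ⟨q - 1, by omega⟩
    have hlt : s + 2 < (t + 1) ^ (s + 1) := by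
      rcases Nat.lt_or_ge t 2 with ht | ht
      · have : t = 1 := by omega
        subst this
        have hs : 1 ≤ s := by
          by_contra h
          exact hqr ⟨rfl, by omega⟩
        clear hqr hn hk hsp
        induction s, hs using Nat.le_induction with
        | base => norm_num
        | succ m hm ih =>
          have := ih (by omega)
          rw [pow_succ]; omega
      · have h3 : 3 ^ (s + 1) ≤ (t + 1) ^ (s + 1) := Nat.pow_le_pow_left (by omega) _
        refine lt_of_lt_of_le ?_ h3
        clear * -
        induction s with
        | zero => norm_num
        | succ m ih => rw [pow_succ]; omega
    have hnk : n = k + (s + 2) := by omega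
    subst hnk
    have e : s + 2 - 1 = s + 1 := rfl
    rw [e]
    have h1 : 1 ≤ (t + 1) ^ (s + 2) := Nat.one_le_pow _ _ (by omega)
    have hn' : (k + (s + 2)) * t + 1 = (t + 1) ^ (s + 2) := by
      simp only [Nat.add_sub_cancel] at hn
      omega
    rw [pow_succ] at hn'
    simp only [Nat.add_sub_cancel]
    have ht : 1 ≤ t := by omega
    nlinarith
  · have hc := Projectivization.card F (Fin r → F)
    have hne : (Fintype.card F - 1) ≠ 0 := by omega
    simp only [Nat.card_eq_fintype_card, Fintype.card_fun, Fintype.card_fin] at hc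
    have hcn : Nat.card (Projectivization F (Fin r → F)) = n :=
      Nat.eq_of_mul_eq_mul_right (Nat.pos_of_ne_zero hne) (hc.symm.trans hn.symm)
    have : Fintype (Projectivization F (Fin r → F)) := Fintype.ofFinite _
    rw [Nat.card_eq_fintype_card] at hcn
    obtain ⟨f⟩ := Function.Embedding.nonempty_of_card_le
      (α := Fin k) (β := Projectivization F (Fin r → F)) (by rw [hcn, Fintype.card_fin]; omega)
    exact hamming_code_bound F k r f f.injective
end

section
/- Let q be a prime power and k ≥ 3. If there exists a systematic single-error-correcting code of message length k and parity length r, i.e., a map P : F_q^k → F_q^r with d_H(u,v) + d_H(P(u),P(v)) ≥ 3 for all distinct u, v ∈ F_q^k, then q^r ≥ (q−1)k + 1; equivalently r ≥ log_q((q−1)k + 1). -/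
/-- The points of the Hamming ball of radius one around zero. -/
def ballPoint {F : Type*} [Field F] {k : ℕ} : Option (Fin k × Fˣ) → (Fin k → F)
  | none => 0
  | some x => Pi.single x.1 (x.2 : F)

theorem ballPoint_dist {F : Type*} [Field F] [DecidableEq F] {k : ℕ}
    (x : Option (Fin k × Fˣ)) : hammingDist (ballPoint x) (0 : Fin k → F) ≤ 1 := by
  rcases x with _ | ⟨i, a⟩
  · simp [ballPoint]
  · unfold hammingDist
    refine (Finset.card_le_card (t := {i}) ?_).trans (by simp)
    intro j hj
    by_contra h
    simp at h
    exact (Finset.mem_filter.1 hj).2 (by simp [ballPoint, h])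

theorem ballPoint_injective {F : Type*} [Field F] {k : ℕ} :
    Function.Injective (ballPoint : Option (Fin k × Fˣ) → (Fin k → F)) := by
  rintro (_ | ⟨i, a⟩) (_ | ⟨j, b⟩) h
  · rfl
  · have := congrFun h j
    simp [ballPoint] at this
    exact absurd this.symm b.ne_zero
  · have := congrFun h i
    simp [ballPoint] at this
  · have h1 := congrFun h i
    by_cases hij : i = j
    · subst hij
      simp [ballPoint] at h1
      rw [Units.ext h1]
    · simp [ballPoint, hij] at h1

/-- If a systematic single-error-correcting (minimum distance 3) code with
message length `k ≥ 3` and parity length `r` exists over `F_q`, then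
`q^r ≥ (q−1)k + 1`. -/
theorem stmt6 {F : Type*} [Field F] [Fintype F] [DecidableEq F]
    {k r : ℕ} (hk : 3 ≤ k) (P : (Fin k → F) → (Fin r → F))
    (hP : ∀ u v : Fin k → F, u ≠ v →
      3 ≤ hammingDist u v + hammingDist (P u) (P v)) :
    (Fintype.card F - 1) * k + 1 ≤ Fintype.card F ^ r := by
  have hinj : Function.Injective (fun x : Option (Fin k × Fˣ) => P (ballPoint x)) := by
    intro x y hxy
    by_contra hne
    have h3 := hP (ballPoint x) (ballPoint y) (fun h => hne (ballPoint_injective h))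
    have h0 : hammingDist (P (ballPoint x)) (P (ballPoint y)) = 0 :=
      hammingDist_eq_zero.2 hxy
    have ht := hammingDist_triangle_right (ballPoint x) (ballPoint y) (0 : Fin k → F)
    have hx := ballPoint_dist x
    have hy := ballPoint_dist y
    omega
  have hc := Fintype.card_le_of_injective _ hinj
  simp only [Fintype.card_option, Fintype.card_prod, Fintype.card_fin, Fintype.card_units,
    Fintype.card_fun] at hc
  rw [mul_comm]
  exact hc
end

section
/- Let q be a prime power, f : F_q^k → F_q^l a surjective linear map, t ∈ ℕ, and s = Σ_{x ∈ ker(f)} w_H(x) the sum of the Hamming weights of the vectors in the kernel of f. If there exists an (f,t)-function-correcting code with redundancy r, then, as real numbers, r ≥ (q/(q−1))·(2t+1)·(1 − q^{−l}) − k + s/((q−1)·q^{k−1}). -/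
open Finset

/-- Coordinate Plotkin count. -/
lemma coord_bound {V F : Type*} [Fintype V] [Fintype F] [DecidableEq F] (c : V → F) :
    (Fintype.card F : ℝ) * (∑ u : V, ∑ v : V, if c u ≠ c v then (1 : ℝ) else 0)
      ≤ ((Fintype.card F : ℝ) - 1) * (Fintype.card V : ℝ) ^ 2 := by
  have h1 : ∑ a : F, (∑ u : V, if c u = a then (1 : ℝ) else 0) = Fintype.card V := by
    rw [sum_comm]; simp
  have h2 : ∑ a : F, (∑ u : V, if c u = a then (1 : ℝ) else 0) ^ 2
      = ∑ u : V, ∑ v : V, if c u = c v then (1 : ℝ) else 0 := by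
    simp_rw [sq, sum_mul_sum]
    rw [sum_comm]
    refine sum_congr rfl fun u _ => ?_
    rw [sum_comm]
    refine sum_congr rfl fun v _ => ?_
    simp [eq_comm]
  have h3 : (∑ u : V, ∑ v : V, if c u ≠ c v then (1 : ℝ) else 0)
      + (∑ u : V, ∑ v : V, if c u = c v then (1 : ℝ) else 0) = (Fintype.card V : ℝ) ^ 2 := by
    simp_rw [← sum_add_distrib]
    have : ∀ u v : V, ((if c u ≠ c v then (1 : ℝ) else 0) + if c u = c v then (1 : ℝ) else 0) = 1 := by
      intro u v; by_cases h : c u = c v <;> simp [h]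
    simp_rw [this]
    simp [sq]
  have h4 := sq_sum_le_card_mul_sum_sq (s := (univ : Finset F))
    (f := fun a => ∑ u : V, if c u = a then (1 : ℝ) else 0)
  rw [h1, h2, card_univ] at h4
  have h5 := congrArg (fun x => (Fintype.card F : ℝ) * x) h3
  simp only [mul_add] at h5
  linarith

lemma dist_bound {V F : Type*} [Fintype V] [Fintype F] [DecidableEq F] {n : ℕ} (g : V → Fin n → F) :
    (Fintype.card F : ℝ) * (∑ u : V, ∑ v : V, (hammingDist (g u) (g v) : ℝ))
      ≤ n * (((Fintype.card F : ℝ) - 1) * (Fintype.card V : ℝ) ^ 2) := by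
  have h : (∑ u : V, ∑ v : V, (hammingDist (g u) (g v) : ℝ))
      = ∑ i : Fin n, ∑ u : V, ∑ v : V, if g u i ≠ g v i then (1 : ℝ) else 0 := by
    symm
    rw [sum_comm]
    refine sum_congr rfl fun u _ => ?_
    rw [sum_comm]
    refine sum_congr rfl fun v _ => ?_
    rw [sum_boole]; rfl
  rw [h, mul_sum]
  refine (sum_le_sum fun i _ => coord_bound (fun u => g u i)).trans ?_
  simp



/-- Plotkin-like bound for linear-function-correcting codes: if
`f : F_q^k → F_q^l` is a surjective linear map,
`s = Σ_{x ∈ ker f} w_H(x)`, and an `(f,t)`-FCC with redundancy `r` exists, then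
`r ≥ (q/(q−1))(2t+1)(1 − q^{−l}) − k + s/((q−1)q^{k−1})`. -/
theorem stmt7 {F : Type*} [Field F] [Fintype F] [DecidableEq F]
    {k l t r : ℕ} (f : (Fin k → F) →ₗ[F] (Fin l → F))
    (hf : Function.Surjective f)
    (P : (Fin k → F) → (Fin r → F))
    (hP : ∀ u v : Fin k → F, f u ≠ f v →
      2 * t + 1 ≤ hammingDist u v + hammingDist (P u) (P v)) :
    ((Fintype.card F : ℝ) / ((Fintype.card F : ℝ) - 1)) * (2 * (t : ℝ) + 1) *
        (1 - ((Fintype.card F : ℝ) ^ l)⁻¹) - (k : ℝ) +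
      ((∑ x ∈ univ.filter (fun x : Fin k → F => f x = 0), hammingNorm x : ℕ) : ℝ) /
        (((Fintype.card F : ℝ) - 1) * (Fintype.card F : ℝ) ^ (k - 1)) ≤ (r : ℝ) := by
  classical
  set q : ℝ := (Fintype.card F : ℝ) with hq
  have hq1 : 1 < q := by
    rw [hq]; exact_mod_cast Fintype.one_lt_card
  have hV : (Fintype.card (Fin k → F) : ℝ) = q ^ k := by simp [hq]
  set K := univ.filter (fun x : Fin k → F => f x = 0) with hK
  set S : ℕ := ∑ x ∈ K, hammingNorm x with hS
  have hA := dist_bound (F := F) (fun u : Fin k → F => u)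
  have hB := dist_bound P
  rw [hV, ← hq] at hA hB
  -- translation: fiber sums
  have htr : ∀ (u : Fin k → F) (φ : (Fin k → F) → ℝ),
      (∑ v : Fin k → F, if f u = f v then φ (v - u) else 0) = ∑ x ∈ K, φ x := by
    intro u φ
    rw [hK, sum_filter, ← (Equiv.subRight u).sum_comp (fun x => if f x = 0 then φ x else 0)]
    refine sum_congr rfl fun v _ => ?_
    simp [sub_eq_zero, eq_comm (a := f u)]
  have hcard : (#K : ℝ) * q ^ l = q ^ k := by
    have hfib : ∀ y : Fin l → F, #(univ.filter fun v : Fin k → F => f v = y) = #K := by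
      intro y
      obtain ⟨u, rfl⟩ := hf y
      have := htr u (fun _ => 1)
      simp only [sum_boole, sum_const, nsmul_eq_mul, mul_one] at this
      have h' : #(univ.filter fun v : Fin k → F => f u = f v) = #K := by exact_mod_cast this
      simpa [eq_comm] using h'
    have h0 := card_eq_sum_card_fiberwise (s := (univ : Finset (Fin k → F)))
      (t := (univ : Finset (Fin l → F))) (f := f) (by simp)
    simp only [hfib] at h0
    simp only [sum_const, card_univ, Fintype.card_pi, prod_const, Fintype.card_fin, smul_eq_mul] at h0
    rw [hq, mul_comm]; exact_mod_cast h0.symm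
  have hpt : ∀ u v : Fin k → F,
      (2 * (t : ℝ) + 1) - (if f u = f v then (2 * (t : ℝ) + 1) else 0)
        + (if f u = f v then (hammingNorm (v - u) : ℝ) else 0)
      ≤ (hammingDist u v : ℝ) + (hammingDist (P u) (P v) : ℝ) := by
    intro u v
    by_cases h : f u = f v
    · rw [if_pos h, if_pos h, hammingDist_eq_hammingNorm u v, neg_add_eq_sub]
      simp
    · rw [if_neg h, if_neg h]
      have := hP u v h
      have h' : ((2 * t + 1 : ℕ) : ℝ) ≤ ((hammingDist u v + hammingDist (P u) (P v) : ℕ) : ℝ) := by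
        exact_mod_cast this
      push_cast at h'
      linarith
  have hsum := sum_le_sum fun u (_ : u ∈ (univ : Finset (Fin k → F))) =>
    sum_le_sum fun v (_ : v ∈ (univ : Finset (Fin k → F))) => hpt u v
  simp only [sum_add_distrib, sum_sub_distrib] at hsum
  simp only [htr _ (fun _ => (2 * (t : ℝ) + 1)), htr _ (fun x => (hammingNorm x : ℝ))] at hsum
  simp only [sum_const, card_univ, nsmul_eq_mul, hV] at hsum
  have hS' : (∑ x ∈ K, (hammingNorm x : ℝ)) = (S : ℝ) := by rw [hS]; push_cast; rfl
  rw [hS'] at hsum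
  have hq0 : 0 < q := by linarith
  have hN : 0 < q ^ k := pow_pos hq0 k
  have hL : 0 < q ^ l := pow_pos hq0 l
  have hKe : (#K : ℝ) = q ^ k * (q ^ l)⁻¹ := by
    rw [← hcard]; field_simp
  rw [hKe] at hsum
  have hSk : (S : ℝ) / ((q - 1) * q ^ (k - 1)) = (S : ℝ) * q / ((q - 1) * q ^ k) := by
    rcases Nat.eq_zero_or_pos k with h | h
    · subst h
      have : S = 0 := by
        rw [hS]; refine sum_eq_zero fun x _ => ?_
        simp [hammingNorm]
      simp [this]
    · obtain ⟨m, rfl⟩ := Nat.exists_eq_succ_of_ne_zero h.ne'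
      have : q - 1 ≠ 0 := by linarith
      simp only [Nat.succ_eq_add_one, Nat.add_sub_cancel, pow_succ]
      field_simp
  rw [hSk]
  have hmain : q * (q ^ k * (q ^ k * (2 * (t : ℝ) + 1)) - q ^ k * (q ^ k * (q ^ l)⁻¹ * (2 * (t : ℝ) + 1))
      + q ^ k * S) ≤ (k + r) * ((q - 1) * (q ^ k) ^ 2) := by
    have := mul_le_mul_of_nonneg_left hsum hq0.le
    linarith
  have hd : 0 < (q - 1) * (q ^ k) ^ 2 := by have : 0 < q - 1 := by linarith
                                            positivity
  have := (div_le_iff₀ hd).2 hmain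
  have e : q * (q ^ k * (q ^ k * (2 * (t : ℝ) + 1)) - q ^ k * (q ^ k * (q ^ l)⁻¹ * (2 * (t : ℝ) + 1))
      + q ^ k * S) / ((q - 1) * (q ^ k) ^ 2)
      = q / (q - 1) * (2 * (t : ℝ) + 1) * (1 - (q ^ l)⁻¹) + (S : ℝ) * q / ((q - 1) * q ^ k) := by
    have h1 : q - 1 ≠ 0 := by linarith
    generalize (q ^ l)⁻¹ = L
    generalize q ^ k = N at hN ⊢
    field_simp
  rw [e] at this
  linarith
end

section
/- Let q be a prime power, f : F_q^k → F_q^l a linear map, and t, r ∈ ℕ. Let A be the (real, symmetric) adjacency matrix of G_f(t,k,r), let λ_max and λ_min be its largest and smallest eigenvalues, and suppose G_f(t,k,r) has at least one edge (so λ_min < 0). If there exists an (f,t)-function-correcting code with redundancy r, then q^r ≥ 1 − λ_max/λ_min. -/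
open scoped Classical

/-- Hoffman-type bound for a real symmetric matrix vanishing on the colour classes. -/
theorem hoffman_aux {V C : Type*} [Fintype V] [DecidableEq V] [Fintype C] [DecidableEq C]
    (A : Matrix V V ℝ) (hH : A.IsHermitian) (col : V → C)
    (hcol : ∀ x y, col x = col y → A x y = 0) (lmax lmin : ℝ)
    (hmax : lmax ∈ spectrum ℝ A) (hmin' : ∀ μ ∈ spectrum ℝ A, lmin ≤ μ) :
    lmax - lmin ≤ (Fintype.card C : ℝ) * (-lmin) := by
  have hpsd : (A - algebraMap ℝ (Matrix V V ℝ) lmin).PosSemidef := by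
    rw [Matrix.posSemidef_iff_isHermitian_and_spectrum_nonneg]
    refine ⟨?_, ?_⟩
    · refine hH.sub ?_
      rw [Matrix.algebraMap_eq_diagonal]
      exact Matrix.isHermitian_diagonal _
    · intro μ hμ
      rw [← spectrum.sub_singleton_eq] at hμ
      obtain ⟨a, ha, b, hb, rfl⟩ := hμ
      rw [Set.mem_singleton_iff] at hb
      subst hb
      exact sub_nonneg.2 (hmin' a ha)
  obtain ⟨B, hB⟩ : ∃ B : Matrix V V ℝ, A - algebraMap ℝ (Matrix V V ℝ) lmin = B.transpose * B := by
    open scoped MatrixOrder in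
    obtain ⟨B, hB⟩ := CStarAlgebra.nonneg_iff_eq_star_mul_self.mp hpsd.nonneg
    exact ⟨B, by simpa [Matrix.star_eq_conjTranspose] using hB⟩
  have hq : ∀ w : V → ℝ, ∑ i, (B.mulVec w i) ^ 2 = w ⬝ᵥ A.mulVec w - lmin * (w ⬝ᵥ w) := by
    intro w
    have h1 : ∑ i, (B.mulVec w i) ^ 2 = B.mulVec w ⬝ᵥ B.mulVec w := by
      simp [dotProduct, sq]
    have h2 : w ⬝ᵥ (B.transpose * B).mulVec w = B.mulVec w ⬝ᵥ B.mulVec w := by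
      rw [← Matrix.mulVec_mulVec, Matrix.dotProduct_mulVec, Matrix.vecMul_transpose]
    rw [h1, ← h2, ← hB, Matrix.sub_mulVec, dotProduct_sub, Algebra.algebraMap_eq_smul_one,
      Matrix.smul_mulVec, Matrix.one_mulVec, dotProduct_smul, smul_eq_mul]
  obtain ⟨z, hz0, hz⟩ : ∃ z : V → ℝ, z ≠ 0 ∧ A.mulVec z = lmax • z := by
    rw [← Matrix.spectrum_toLin', ← Module.End.hasEigenvalue_iff_mem_spectrum] at hmax
    obtain ⟨z, hz⟩ := hmax.exists_hasEigenvector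
    exact ⟨z, hz.2, by simpa using hz.apply_eq_smul⟩
  let zc : C → V → ℝ := fun c x => if col x = c then z x else 0
  have hsum : ∑ c, zc c = z := by
    ext x; simp [zc, Finset.sum_apply]
  have hzA : ∀ c, zc c ⬝ᵥ A.mulVec (zc c) = 0 := by
    intro c
    simp only [dotProduct, Matrix.mulVec]
    refine Finset.sum_eq_zero fun x _ => ?_
    by_cases hx : col x = c
    · rw [Finset.sum_eq_zero, mul_zero]
      intro y _
      by_cases hy : col y = c
      · rw [hcol x y (hx.trans hy.symm), zero_mul]
      · simp [zc, hy]
    · simp [zc, hx]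
  have hzz : ∑ c, zc c ⬝ᵥ zc c = z ⬝ᵥ z := by
    simp only [dotProduct]
    rw [Finset.sum_comm]
    refine Finset.sum_congr rfl fun x _ => ?_
    simp [zc]
  have hBs : ∀ i, B.mulVec z i = ∑ c, B.mulVec (zc c) i := by
    intro i
    conv_lhs => rw [← hsum]
    rw [Matrix.mulVec_sum, Finset.sum_apply]
  have key : ∑ i, (B.mulVec z i) ^ 2 ≤
      (Fintype.card C : ℝ) * ∑ c, ∑ i, (B.mulVec (zc c) i) ^ 2 := by
    rw [Finset.sum_comm, Finset.mul_sum]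
    refine Finset.sum_le_sum fun i _ => ?_
    rw [hBs]
    exact sq_sum_le_card_mul_sum_sq
  simp only [hq, hzA, hz, zero_sub, dotProduct_smul, smul_eq_mul] at key
  rw [Finset.sum_neg_distrib, ← Finset.mul_sum, hzz] at key
  have hpos : 0 < z ⬝ᵥ z := by
    refine lt_of_le_of_ne (Finset.sum_nonneg fun i _ => mul_self_nonneg _) fun h => hz0 ?_
    exact dotProduct_self_eq_zero.1 h.symm
  refine le_of_mul_le_mul_right ?_ hpos
  linarith

/-- Eigenvalue (ratio/Hoffman-type) bound on the redundancy of an `(f,t)`-FCC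
for a linear map `f`: if `A` is the adjacency matrix of `G_f(t,k,r)`, with
largest and smallest eigenvalues `λmax` and `λmin`, the graph has at least one
edge, and an `(f,t)`-FCC with redundancy `r` exists, then
`q^r ≥ 1 − λmax/λmin`. -/
theorem stmt12 {F : Type*} [Field F] [Fintype F] [DecidableEq F]
    {k l t r : ℕ} (f : (Fin k → F) →ₗ[F] (Fin l → F))
    (A : Matrix ((Fin k → F) × (Fin r → F)) ((Fin k → F) × (Fin r → F)) ℝ)
    (hA : ∀ x y, A x y =
      if (GfGraph (r := r) (fun u => f u) t).Adj x y then 1 else 0)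
    (lmax lmin : ℝ)
    (hmax : lmax ∈ spectrum ℝ A) (hmax' : ∀ μ ∈ spectrum ℝ A, μ ≤ lmax)
    (hmin : lmin ∈ spectrum ℝ A) (hmin' : ∀ μ ∈ spectrum ℝ A, lmin ≤ μ)
    (hedge : ∃ x y, (GfGraph (r := r) (fun u => f u) t).Adj x y)
    (P : (Fin k → F) → (Fin r → F))
    (hP : ∀ u v : Fin k → F, f u ≠ f v →
      2 * t + 1 ≤ hammingDist u v + hammingDist (P u) (P v)) :
    1 - lmax / lmin ≤ (Fintype.card F : ℝ) ^ r := by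
  have hsymm : A.IsHermitian := by
    ext x y
    rw [Matrix.conjTranspose_apply, hA, hA, SimpleGraph.adj_comm]
    simp
  have hb := hoffman_aux A hsymm (fun x => x.2 - P x.1) (by
    intro x y hxy
    rw [hA, if_neg]
    have hxy' : x.2 - P x.1 = y.2 - P y.1 := hxy
    have hcore : ∀ x y : (Fin k → F) × (Fin r → F), x ≠ y → x.2 - P x.1 = y.2 - P y.1 →
        ¬ (x.1 = y.1 ∨ (f x.1 ≠ f y.1 ∧
          hammingDist x.1 y.1 + hammingDist x.2 y.2 ≤ 2 * t)) := by
      rintro ⟨u, a⟩ ⟨v, b⟩ hne h (h1 | ⟨h1, h2⟩)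
      · simp only at h h1
        subst h1
        exact hne (by rw [sub_left_inj.1 h])
      · simp only at h h1 h2
        have h3 := hP u v h1
        have h4 : hammingDist a b = hammingDist (P u) (P v) := by
          rw [hammingDist_eq_hammingNorm, hammingDist_eq_hammingNorm]
          congr 1
          rw [sub_eq_sub_iff_sub_eq_sub] at h
          rw [neg_add_eq_sub, neg_add_eq_sub, ← neg_sub a b, h, neg_sub]
        omega
    rw [GfGraph, SimpleGraph.fromRel_adj]
    rintro ⟨hne, h | h⟩
    · exact hcore x y hne hxy' h
    · exact hcore y x hne.symm hxy'.symm h) lmax lmin hmax hmin'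
  have hcard : (Fintype.card (Fin r → F) : ℝ) = (Fintype.card F : ℝ) ^ r := by
    simp
  rw [hcard] at hb
  have hq1 : (1 : ℝ) ≤ (Fintype.card F : ℝ) ^ r := by
    apply one_le_pow₀
    exact_mod_cast Fintype.card_pos (α := F)
  rcases lt_or_ge lmin 0 with hneg | hnn
  · have e : 1 - lmax / lmin = (lmax - lmin) / (-lmin) := by
      field_simp [hneg.ne]
      ring
    rw [e, div_le_iff₀ (by linarith)]
    exact hb
  · have h0 : 0 ≤ lmax / lmin := div_nonneg (hnn.trans (hmax' _ hmin)) hnn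
    linarith
end

section
/- Let f : F_2^k → F_2^l be a surjective linear map. There exists a linear subspace S of F_2^k that contains exactly one element of each coset of ker(f) and in which every element has minimum Hamming weight within its coset, if and only if exactly l cosets of ker(f) contain a standard basis vector as a minimum-weight element (equivalently, the number of distinct nonzero vectors among f(e_1),…,f(e_k) is exactly l). -/
open Finset

theorem aux_z2 : ∀ a : ZMod 2, a ≠ 0 → a = 1 := by decide

theorem aux_single {k : ℕ} (x : Fin k → ZMod 2) (hx : x ≠ 0) (h : hammingNorm x ≤ 1) :
    ∃ j, x = Pi.single j 1 := by
  obtain ⟨j, hj⟩ := Function.ne_iff.mp hx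
  refine ⟨j, ?_⟩
  ext i
  by_cases hij : i = j
  · subst hij
    rw [Pi.single_eq_same]
    exact aux_z2 _ hj
  · rw [Pi.single_eq_of_ne hij]
    by_contra hi
    unfold hammingNorm at h
    rw [Finset.card_le_one] at h
    exact hij (h i (by simpa using hi) j (by simpa using hj))

theorem aux_norm_single {k : ℕ} (j : Fin k) :
    hammingNorm (Pi.single j (1 : ZMod 2) : Fin k → ZMod 2) = 1 := by
  unfold hammingNorm
  rw [Finset.card_eq_one]
  refine ⟨j, ?_⟩
  ext i
  by_cases h : i = j
  · subst h; simp
  · simp [h]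

theorem aux_add {k : ℕ} (x y : Fin k → ZMod 2) :
    hammingNorm (x + y) ≤ hammingNorm x + hammingNorm y := by
  unfold hammingNorm
  refine le_trans (Finset.card_le_card ?_) (Finset.card_union_le _ _)
  intro i
  simp only [Finset.mem_filter, Finset.mem_univ, true_and, Finset.mem_union, Pi.add_apply]
  intro h
  by_contra! hc
  exact h (by rw [hc.1, hc.2, add_zero])

theorem aux_decomp {k : ℕ} (v : Fin k → ZMod 2) :
    v = ∑ i ∈ univ.filter (fun i => v i ≠ 0), Pi.single i (1 : ZMod 2) := by
  ext j
  rw [Finset.sum_apply]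
  simp only [Pi.single_apply, Finset.sum_ite_eq, Finset.mem_filter, Finset.mem_univ, true_and]
  split_ifs with h
  · exact aux_z2 _ h
  · simpa using h

theorem aux_contract {k : ℕ} (h : (Fin k → ZMod 2) →ₗ[ZMod 2] (Fin k → ZMod 2))
    (hh : ∀ i, hammingNorm (h (Pi.single i 1)) ≤ 1) (v : Fin k → ZMod 2) :
    hammingNorm (h v) ≤ hammingNorm v := by
  conv_lhs => rw [aux_decomp v, map_sum]
  refine le_trans (Finset.le_sum_of_subadditive (hammingNorm (ι := Fin k) (β := fun _ => ZMod 2))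
    hammingNorm_zero.le aux_add _ _) ?_
  refine le_trans (Finset.sum_le_card_nsmul _ _ 1 (fun i _ => hh i)) ?_
  simp [hammingNorm]

theorem aux_span {k l : ℕ} (f : (Fin k → ZMod 2) →ₗ[ZMod 2] (Fin l → ZMod 2))
    (hf : Function.Surjective f) :
    ⊤ ≤ Submodule.span (ZMod 2) (Set.range (Subtype.val :
      ((univ.image fun j : Fin k => f (Pi.single j 1)).erase 0 : Finset _) → _)) := by
  intro y _
  obtain ⟨v, rfl⟩ := hf y
  rw [aux_decomp v, map_sum]
  refine Submodule.sum_mem _ fun i _ => ?_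
  by_cases h : f (Pi.single i 1) = 0
  · rw [h]; exact Submodule.zero_mem _
  · refine Submodule.subset_span ⟨⟨_, ?_⟩, rfl⟩
    exact Finset.mem_erase.mpr ⟨h, Finset.mem_image_of_mem _ (Finset.mem_univ i)⟩

/-- For a surjective linear map `f : F_2^k → F_2^l`, there is a linear subspace
`S` of `F_2^k` containing exactly one element of each coset of `ker f`
(i.e., exactly one preimage of each value of `f`) all of whose elements have
minimum Hamming weight within their coset, if and only if exactly `l` cosets of
`ker f` contain a standard basis vector as a minimum-weight element
(equivalently, the number of distinct nonzero vectors among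
`f(e_1), …, f(e_k)` is exactly `l`). -/
theorem stmt14 {k l : ℕ}
    (f : (Fin k → ZMod 2) →ₗ[ZMod 2] (Fin l → ZMod 2))
    (hf : Function.Surjective f) :
    (∃ S : Submodule (ZMod 2) (Fin k → ZMod 2),
      (∀ y : Fin l → ZMod 2, ∃! x : Fin k → ZMod 2, x ∈ S ∧ f x = y) ∧
      (∀ x ∈ S, ∀ v : Fin k → ZMod 2, f v = f x → hammingNorm x ≤ hammingNorm v))
    ↔ ((univ.image fun j : Fin k => f (Pi.single j 1)).erase 0).card = l := by
  have hspan := aux_span f hf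
  have hpre : ∀ t : ((univ.image fun j : Fin k => f (Pi.single j 1)).erase 0 : Finset _),
      ∃ j, f (Pi.single j 1) = t.1 := by
    intro t
    obtain ⟨j, -, hj⟩ := Finset.mem_image.mp (Finset.mem_of_mem_erase t.2)
    exact ⟨j, hj⟩
  constructor
  · rintro ⟨S, hS, hmin⟩
    have hpre' : ∀ t : ((univ.image fun j : Fin k => f (Pi.single j 1)).erase 0 : Finset _),
        ∃ j, Pi.single j 1 ∈ S ∧ f (Pi.single j 1) = t.1 := by
      intro t
      obtain ⟨i, hi⟩ := hpre t
      obtain ⟨x, ⟨hxS, hx⟩, -⟩ := hS t.1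
      have h1 := hmin x hxS (Pi.single i 1) (by rw [hi, hx])
      rw [aux_norm_single] at h1
      have hx0 : x ≠ 0 := by
        rintro rfl
        rw [map_zero] at hx
        exact Finset.ne_of_mem_erase t.2 hx.symm
      obtain ⟨j, rfl⟩ := aux_single x hx0 h1
      exact ⟨j, hxS, hx⟩
    choose j hjS hj using hpre'
    have hinj : Function.Injective j := by
      intro a b hab
      apply Subtype.ext
      rw [← hj a, ← hj b, hab]
    have hli := (Pi.basisFun (ZMod 2) (Fin k)).linearIndependent.comp j hinj
    have hli2 := hli.map (f := f) (by
      rw [Submodule.disjoint_def]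
      intro x hx hx0
      have hxS : x ∈ S := by
        refine Submodule.span_le.mpr ?_ hx
        rintro _ ⟨t, rfl⟩
        simpa using hjS t
      exact (hS 0).unique ⟨hxS, hx0⟩ ⟨S.zero_mem, map_zero f⟩)
    have heq : (f ∘ (Pi.basisFun (ZMod 2) (Fin k)) ∘ j) = Subtype.val := by
      funext t
      simpa using hj t
    rw [heq] at hli2
    have := Module.finrank_eq_card_basis (Module.Basis.mk hli2 hspan)
    rw [Module.finrank_fin_fun, Fintype.card_coe] at this
    exact this.symm
  · intro hc
    have hli := linearIndependent_of_top_le_span_of_card_eq_finrank hspan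
      (by rw [Module.finrank_fin_fun, Fintype.card_coe, hc])
    let b := Module.Basis.mk hli hspan
    choose j hj using hpre
    let g : (Fin l → ZMod 2) →ₗ[ZMod 2] (Fin k → ZMod 2) :=
      b.constr (ZMod 2) fun t => Pi.single (j t) 1
    have hgb : ∀ t, g t.1 = Pi.single (j t) 1 := by
      intro t
      have h1 : b t = t.1 := Module.Basis.mk_apply hli hspan t
      rw [← h1]
      exact b.constr_basis (ZMod 2) _ t
    have hfg : ∀ y, f (g y) = y := by
      have : f ∘ₗ g = LinearMap.id := by
        refine b.ext fun t => ?_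
        have h1 : b t = t.1 := Module.Basis.mk_apply hli hspan t
        rw [h1, LinearMap.comp_apply, hgb, hj, LinearMap.id_apply]
      intro y
      exact LinearMap.congr_fun this y
    refine ⟨LinearMap.range g, ?_, ?_⟩
    · intro y
      refine ⟨g y, ⟨⟨y, rfl⟩, hfg y⟩, ?_⟩
      rintro _ ⟨⟨z, rfl⟩, hz⟩
      rw [hfg] at hz
      rw [hz]
    · rintro _ ⟨y, rfl⟩ v hv
      rw [hfg] at hv
      rw [← hv]
      refine aux_contract (g ∘ₗ f) (fun i => ?_) v
      rw [LinearMap.comp_apply]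
      by_cases h : f (Pi.single i 1) = 0
      · rw [h, map_zero, hammingNorm_zero]; exact Nat.zero_le _
      · have := hgb ⟨f (Pi.single i 1),
          Finset.mem_erase.mpr ⟨h, Finset.mem_image_of_mem _ (Finset.mem_univ i)⟩⟩
        rw [this, aux_norm_single]
end

section
/- Let q be a prime power and f : F_q^k → F_q^l a surjective linear map such that the number of distinct nonzero vectors among f(e_1),…,f(e_k) is exactly l (i.e., the matrix of f has exactly l distinct nonzero columns). Then there exists a right inverse u : F_q^l → F_q^k of f (so f(u(y)) = y for all y) such that for all y ≠ y' in F_q^l, d_H(u(y), u(y')) = d_f(y, y') := min{d_H(x, x') : x, x' ∈ F_q^k, f(x) = y, f(x') = y'}. Consequently, for every t ∈ ℕ the function distance matrix with entries [2t+1 − d_f(y,y')]^+ (y ≠ y') equals the distance-requirement matrix of the representatives u(y), with entries [2t+1 − d_H(u(y),u(y'))]^+. -/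
open Finset

/-- The function distance `d_f(y,y') = min{d_H(x,x') : f x = y, f x' = y'}`. -/
noncomputable def funDist {F : Type*} [Field F] [Fintype F] [DecidableEq F] {k l : ℕ}
    (f : (Fin k → F) →ₗ[F] (Fin l → F)) (y y' : Fin l → F) : ℕ :=
  sInf {m | ∃ x x' : Fin k → F, f x = y ∧ f x' = y' ∧ hammingDist x x' = m}

/-- If a surjective linear map `f : F_q^k → F_q^l` has exactly `l` distinct
nonzero columns, then there is a right inverse `u` of `f` whose values realize
the function distances: `d_H(u y, u y') = d_f(y,y')` for all `y ≠ y'`.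
Consequently, for every `t`, the function distance matrix with entries
`[2t+1 − d_f(y,y')]⁺` coincides with the distance requirement matrix of the
representatives `u y`. -/
theorem stmt15 {F : Type*} [Field F] [Fintype F] [DecidableEq F]
    {k l : ℕ} (f : (Fin k → F) →ₗ[F] (Fin l → F))
    (hf : Function.Surjective f)
    (hcol : ((univ.image fun j : Fin k => f (Pi.single j 1)).erase 0).card = l) :
    ∃ u : (Fin l → F) → (Fin k → F),
      (∀ y, f (u y) = y) ∧
      (∀ y y' : Fin l → F, y ≠ y' →
        hammingDist (u y) (u y') = funDist f y y') ∧
      (∀ t : ℕ, ∀ y y' : Fin l → F, y ≠ y' →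
        (2 * t + 1) - funDist f y y' = (2 * t + 1) - hammingDist (u y) (u y')) := by
  classical
  set c : Fin k → (Fin l → F) := fun j => f (Pi.single j 1) with hc
  set S : Finset (Fin l → F) := (univ.image c).erase 0 with hS
  have hfx : ∀ x, f x = ∑ i, x i • c i := by
    intro x
    conv_lhs => rw [← Finset.univ_sum_single x]
    rw [map_sum]
    refine Finset.sum_congr rfl fun i _ => ?_
    rw [hc, ← map_smul]
    congr 1
    rw [← Pi.single_smul]
    simp
  have hmem : ∀ i, c i ≠ 0 → c i ∈ S := by
    intro i hi
    simp [hS, hi]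
  have hspan : ⊤ ≤ Submodule.span F (Set.range (fun s : S => (s : Fin l → F))) := by
    intro y _
    obtain ⟨x, rfl⟩ := hf y
    rw [hfx]
    refine Submodule.sum_mem _ fun i _ => Submodule.smul_mem _ _ ?_
    by_cases hi : c i = 0
    · rw [hi]; exact Submodule.zero_mem _
    · exact Submodule.subset_span ⟨⟨c i, hmem i hi⟩, rfl⟩
  have hli : LinearIndependent F (fun s : S => (s : Fin l → F)) := by
    apply linearIndependent_of_top_le_span_of_card_eq_finrank hspan
    simpa using hcol
  let b := Module.Basis.mk hli hspan
  have hb : ∀ s : S, b s = (s : Fin l → F) := fun s => by simp [b]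
  have hJ : ∀ s : S, ∃ j, c j = s := by
    rintro ⟨s, hs⟩
    simp only [hS, Finset.mem_erase, Finset.mem_image, Finset.mem_univ, true_and] at hs
    exact hs.2
  choose J hJ using hJ
  let u : (Fin l → F) → (Fin k → F) := fun y => ∑ s : S, b.repr y s • Pi.single (J s) (1 : F)
  have hu : ∀ y, f (u y) = y := by
    intro y
    have h1 : f (u y) = ∑ s : S, b.repr y s • b s := by
      simp only [u, map_sum, map_smul]
      refine Finset.sum_congr rfl fun s _ => ?_
      rw [hb, ← hJ s]
    rw [h1, b.sum_repr]
  have key : ∀ x x' : Fin k → F, ∀ y y', f x = y → f x' = y' →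
      hammingDist (u y) (u y') ≤ hammingDist x x' := by
    intro x x' y y' hx hx'
    let T : Finset S := univ.filter fun s => b.repr y s ≠ b.repr y' s
    have h1 : hammingDist (u y) (u y') ≤ T.card := by
      refine le_trans (Finset.card_le_card ?_) (Finset.card_image_le (s := T) (f := J))
      intro i hi
      simp only [Finset.mem_filter, Finset.mem_univ, true_and] at hi
      by_contra hcon
      apply hi
      simp only [u, Finset.sum_apply, Pi.smul_apply]
      refine Finset.sum_congr rfl fun s _ => ?_
      by_cases hs : J s = i
      · have : b.repr y s = b.repr y' s := by
          by_contra hne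
          exact hcon (Finset.mem_image.2 ⟨s, by simp [T, hne], hs⟩)
        rw [this]
      · simp [Pi.single_apply, Ne.symm hs]
    have h2 : T.card ≤ hammingDist x x' := by
      rw [← Finset.card_map (Function.Embedding.subtype _)]
      refine le_trans (Finset.card_le_card ?_)
        (Finset.card_image_le (s := univ.filter fun i => x i ≠ x' i) (f := c))
      intro v hv
      obtain ⟨s, hs, rfl⟩ := Finset.mem_map.1 hv
      simp only [T, Finset.mem_filter, Finset.mem_univ, true_and] at hs
      by_contra hcon
      apply hs
      rw [← hx, ← hx', hfx, hfx]
      simp only [map_sum, map_smul, Finsupp.coe_finset_sum, Finset.sum_apply,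
        Finsupp.smul_apply]
      refine Finset.sum_congr rfl fun i _ => ?_
      by_cases hi : x i = x' i
      · rw [hi]
      · have hne : c i ≠ s := fun h => hcon (Finset.mem_image.2 ⟨i, by simp [hi], h⟩)
        have h0 : b.repr (c i) s = 0 := by
          by_cases hz : c i = 0
          · simp [hz]
          · have := hb ⟨c i, hmem i hz⟩
            simp only at this
            rw [← this, b.repr_self, Finsupp.single_apply, if_neg]
            intro h
            exact hne (congrArg Subtype.val h)
        simp [h0]
    exact h1.trans h2
  have hd : ∀ y y', hammingDist (u y) (u y') = funDist f y y' := by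
    intro y y'
    have hm : hammingDist (u y) (u y') ∈
        {m | ∃ x x' : Fin k → F, f x = y ∧ f x' = y' ∧ hammingDist x x' = m} :=
      ⟨_, _, hu y, hu y', rfl⟩
    apply le_antisymm
    · refine le_csInf ⟨_, hm⟩ ?_
      rintro m ⟨x, x', h, h', rfl⟩
      exact key x x' y y' h h'
    · exact Nat.sInf_le hm
  exact ⟨u, hu, fun y y' _ => hd y y', fun t y y' _ => by rw [hd]⟩
end

section
/- Let q be a prime power, f : F_q^k → F_q^l a surjective linear map such that the number of distinct nonzero vectors among f(e_1),…,f(e_k) is exactly l, and t, r ∈ ℕ. If there exists a systematic (l+r, q^l, 2t+1)_q code, i.e., a map g : F_q^l → F_q^r with d_H(a,b) + d_H(g(a), g(b)) ≥ 2t+1 for all distinct a, b ∈ F_q^l, then there exists an (f,t)-function-correcting code P : F_q^k → F_q^r with redundancy r that is constant on each coset of ker(f) (i.e., P(u) depends only on f(u)). -/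
open Finset

/-- Coset-wise coding: if a surjective linear map `f : F_q^k → F_q^l` has
exactly `l` distinct nonzero columns and there exists a systematic
`(l+r, q^l, 2t+1)_q` code `g`, then there exists an `(f,t)`-function-correcting
code `P` with redundancy `r` that is constant on each coset of `ker f`. -/
theorem stmt17 {F : Type*} [Field F] [Fintype F] [DecidableEq F]
    {k l t r : ℕ} (f : (Fin k → F) →ₗ[F] (Fin l → F))
    (hf : Function.Surjective f)
    (hcol : ((univ.image fun j : Fin k => f (Pi.single j 1)).erase 0).card = l)
    (g : (Fin l → F) → (Fin r → F))
    (hg : ∀ a b : Fin l → F, a ≠ b →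
      2 * t + 1 ≤ hammingDist a b + hammingDist (g a) (g b)) :
    ∃ P : (Fin k → F) → (Fin r → F),
      (∀ u v : Fin k → F, f u ≠ f v →
        2 * t + 1 ≤ hammingDist u v + hammingDist (P u) (P v)) ∧
      (∀ u v : Fin k → F, f u = f v → P u = P v) := by
  classical
  set S := (univ.image fun j : Fin k => f (Pi.single j 1)).erase 0 with hS
  have hsum : ∀ w : Fin k → F, f w = ∑ j, w j • f (Pi.single j 1) := by
    intro w
    conv_lhs => rw [pi_eq_sum_univ' w]
    rw [map_sum]
    refine Finset.sum_congr rfl fun j _ => ?_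
    rw [map_smul]
  let e : Fin l ≃ S := (finCongr hcol.symm).trans S.equivFin.symm
  let s : Fin l → (Fin l → F) := fun i => (e i : Fin l → F)
  have hsinj : Function.Injective s := Subtype.val_injective.comp e.injective
  have hmem : ∀ j, f (Pi.single j 1) ≠ 0 → ∃ i, s i = f (Pi.single j 1) := by
    intro j hj
    have hj' : f (Pi.single j 1) ∈ S := by
      rw [hS, Finset.mem_erase]
      exact ⟨hj, Finset.mem_image_of_mem _ (Finset.mem_univ j)⟩
    exact ⟨e.symm ⟨_, hj'⟩, by simp [s]⟩
  have hspan : ⊤ ≤ Submodule.span F (Set.range s) := by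
    intro x _
    obtain ⟨w, rfl⟩ := hf x
    rw [hsum w]
    refine Submodule.sum_mem _ fun j _ => Submodule.smul_mem _ _ ?_
    by_cases hj : f (Pi.single j 1) = 0
    · rw [hj]; exact Submodule.zero_mem _
    · obtain ⟨i, hi⟩ := hmem j hj
      rw [← hi]
      exact Submodule.subset_span ⟨i, rfl⟩
  let b := basisOfTopLeSpanOfCardEqFinrank s hspan (by simp)
  have hb : ∀ i, b i = s i := fun i => by simp [b]
  have key : ∀ (w : Fin k → F) (i : Fin l), b.equivFun (f w) i ≠ 0 →
      ∃ j, w j ≠ 0 ∧ f (Pi.single j 1) = s i := by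
    intro w i h
    rw [hsum w, map_sum, Finset.sum_apply] at h
    obtain ⟨j, _, hj⟩ := Finset.exists_ne_zero_of_sum_ne_zero h
    rw [map_smul, Pi.smul_apply, smul_eq_mul] at hj
    have h1 := left_ne_zero_of_mul hj
    have h2 := right_ne_zero_of_mul hj
    refine ⟨j, h1, ?_⟩
    have h0 : f (Pi.single j 1) ≠ 0 := by
      intro h0
      apply h2
      rw [h0]; simp
    obtain ⟨i', hi'⟩ := hmem j h0
    rw [← hi'] at h2 ⊢
    rw [← hb i', Module.Basis.equivFun_self] at h2
    by_cases hii : i' = i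
    · rw [hii]
    · simp [hii] at h2
  refine ⟨fun u => g (b.equivFun (f u)), fun u v huv => ?_, fun u v huv => by simp [huv]⟩
  refine (hg _ _ (fun h => huv (b.equivFun.injective h))).trans (Nat.add_le_add_right ?_ _)
  have key2 : ∀ i, b.equivFun (f u) i ≠ b.equivFun (f v) i →
      ∃ j, u j ≠ v j ∧ f (Pi.single j 1) = s i := by
    intro i hi
    obtain ⟨j, h1, h2⟩ := key (u - v) i (by
      rw [map_sub, map_sub, Pi.sub_apply]; exact sub_ne_zero.mpr hi)
    exact ⟨j, sub_ne_zero.mp h1, h2⟩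
  obtain ⟨j0, _⟩ := Function.ne_iff.mp (fun h : u = v => huv (by rw [h]))
  have : Nonempty (Fin k) := ⟨j0⟩
  choose! c hc using key2
  unfold hammingDist
  refine Finset.card_le_card_of_injOn c ?_ ?_
  · intro i hi
    have hi' := (Finset.mem_filter.mp hi).2
    exact Finset.mem_coe.mpr (Finset.mem_filter.mpr ⟨Finset.mem_univ _, (hc i hi').1⟩)
  · intro i hi i' hi' hcc
    have h1 := (hc i (Finset.mem_filter.mp hi).2).2
    have h2 := (hc i' (Finset.mem_filter.mp hi').2).2
    apply hsinj
    rw [← h1, ← h2, hcc]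
end
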